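/- arXiv:1708.06940 — 5 statements merged into one kernel-verified Lean document; each statement's English description precedes it below -/
import Mathlib

section
/- Let T be a real 3×3 matrix, s ∈ ℝ³, λ ≥ 0 and γ ∈ ℝ, and let v, ṽ be the two largest eigenvalues of T Tᵗ. Then for every pair of orthonormal vectors ĉ, ĉ′ ∈ ℝ³ and every θ ∈ ℝ: 2λ(‖T ĉ‖ cos θ + ‖T ĉ′‖ sin θ) + 2γ(cos θ ⟨ĉ, s⟩ + sin θ ⟨ĉ′, s⟩) ≤ 2λ√(v + ṽ) + 2|γ| ‖s‖. -/
open Matrix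

lemma aux_rayleigh (A : Matrix (Fin 3) (Fin 3) ℝ) (hA : A.IsHermitian) (m : ℝ)
    (h : ∀ k, m ≤ hA.eigenvalues k) (x : Fin 3 → ℝ) : m * (x ⬝ᵥ x) ≤ x ⬝ᵥ (A *ᵥ x) := by
  set U : Matrix (Fin 3) (Fin 3) ℝ := (hA.eigenvectorUnitary : Matrix (Fin 3) (Fin 3) ℝ) with hU
  have hsp : A = U * diagonal hA.eigenvalues * Uᵀ := by
    have := hA.spectral_theorem
    rw [Unitary.conjStarAlgAut_apply] at this
    simpa [hU, star_eq_conjTranspose, conjTranspose_eq_transpose_of_trivial, Function.comp_def] using this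
  have hUU : U * Uᵀ = 1 := by
    have := Unitary.coe_mul_star_self hA.eigenvectorUnitary
    simpa [hU, star_eq_conjTranspose, conjTranspose_eq_transpose_of_trivial] using this
  generalize hA.eigenvalues = d at *
  set y := Uᵀ *ᵥ x with hy
  have h1 : x ⬝ᵥ (A *ᵥ x) = y ⬝ᵥ (diagonal d *ᵥ y) := by
    rw [hsp, ← mulVec_mulVec, ← mulVec_mulVec, dotProduct_mulVec, ← mulVec_transpose]
  have h2 : x ⬝ᵥ x = y ⬝ᵥ y := by
    have : x ⬝ᵥ ((U * Uᵀ) *ᵥ x) = y ⬝ᵥ y := by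
      rw [← mulVec_mulVec, dotProduct_mulVec, ← mulVec_transpose]
    rw [← this, hUU, one_mulVec]
  rw [h1, h2]
  simp only [dotProduct, mulVec_diagonal, Finset.mul_sum]
  refine Finset.sum_le_sum fun k _ => ?_
  nlinarith [mul_le_mul_of_nonneg_right (h k) (mul_self_nonneg (y k))]

lemma aux_trace (T : Matrix (Fin 3) (Fin 3) ℝ) (c c' : Fin 3 → ℝ) (hc : c ⬝ᵥ c = 1)
    (hc' : c' ⬝ᵥ c' = 1) (hcc' : c ⬝ᵥ c' = 0) : ∃ e : Fin 3 → ℝ, e ⬝ᵥ e = 1 ∧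
    T *ᵥ c ⬝ᵥ T *ᵥ c + T *ᵥ c' ⬝ᵥ T *ᵥ c' + T *ᵥ e ⬝ᵥ T *ᵥ e = (T * Tᵀ).trace := by
  have he : (c ⨯₃ c') ⬝ᵥ (c ⨯₃ c') = 1 := by
    rw [cross_dot_cross, hc, hc', hcc', dotProduct_comm c' c, hcc']; norm_num
  have h1 := dot_self_cross c c'
  have h2 := dot_cross_self c c'
  refine ⟨c ⨯₃ c', he, ?_⟩
  generalize c ⨯₃ c' = e at *
  set Q : Matrix (Fin 3) (Fin 3) ℝ := of ![c, c', e] with hQ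
  have hQQ : Q * Qᵀ = 1 := by
    ext a b
    rw [mul_apply']
    fin_cases a <;> fin_cases b <;>
      simp [hQ, transpose_apply] <;>
      first
        | exact hc | exact hc' | exact hcc' | exact he | exact h1 | exact h2
        | exact (dotProduct_comm _ _).trans hcc' | exact (dotProduct_comm _ _).trans h1
        | exact (dotProduct_comm _ _).trans h2
  have hQ2 := mul_eq_one_comm.mp hQQ
  have : T * Tᵀ = (T * Qᵀ) * (T * Qᵀ)ᵀ := by
    rw [transpose_mul, transpose_transpose, Matrix.mul_assoc T, ← Matrix.mul_assoc Qᵀ, hQ2, Matrix.one_mul]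
  rw [this]
  have q0 : ∀ k, Q 0 k = c k := fun _ => rfl
  have q1 : ∀ k, Q 1 k = c' k := fun _ => rfl
  have q2 : ∀ k, Q 2 k = e k := fun _ => rfl
  simp only [trace, diag_apply, transpose_apply, q0, q1, q2, mul_apply, dotProduct, mulVec, Fin.sum_univ_three]
  ring

lemma aux_cs (s w : Fin 3 → ℝ) (g : ℝ) (hw : w ⬝ᵥ w = 1) :
    g * (w ⬝ᵥ s) ≤ |g| * Real.sqrt (s ⬝ᵥ s) := by
  have : |w ⬝ᵥ s| ≤ Real.sqrt (s ⬝ᵥ s) := by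
    apply Real.abs_le_sqrt
    have := Finset.sum_mul_sq_le_sq_mul_sq Finset.univ w s
    simp only [dotProduct] at *
    simp only [pow_two] at *
    rw [hw, one_mul] at this
    exact this
  calc _ ≤ |g * (w ⬝ᵥ s)| := le_abs_self _
    _ = |g| * |w ⬝ᵥ s| := abs_mul _ _
    _ ≤ _ := by gcongr

theorem chsh_theta_bound
    (T : Matrix (Fin 3) (Fin 3) ℝ) (s : Fin 3 → ℝ) (lam gam : ℝ) (hlam : 0 ≤ lam)
    (hH : (T * Tᵀ).IsHermitian)
    (v vt : ℝ) (i j : Fin 3) (hij : i ≠ j)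
    (hv : v = hH.eigenvalues i) (hvt : vt = hH.eigenvalues j)
    (htop : ∀ k, k ≠ i → k ≠ j → hH.eigenvalues k ≤ min v vt)
    (c c' : Fin 3 → ℝ) (hc : c ⬝ᵥ c = 1) (hc' : c' ⬝ᵥ c' = 1) (hcc' : c ⬝ᵥ c' = 0)
    (θ : ℝ) :
    2 * lam * (Real.sqrt (T.mulVec c ⬝ᵥ T.mulVec c) * Real.cos θ
        + Real.sqrt (T.mulVec c' ⬝ᵥ T.mulVec c') * Real.sin θ)
      + 2 * gam * (Real.cos θ * (c ⬝ᵥ s) + Real.sin θ * (c' ⬝ᵥ s))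
      ≤ 2 * lam * Real.sqrt (v + vt) + 2 * |gam| * Real.sqrt (s ⬝ᵥ s) := by
  have hG : (Tᵀ * T).IsHermitian := by
    simpa [conjTranspose_eq_transpose_of_trivial] using isHermitian_conjTranspose_mul_self T
  have heq : hG.eigenvalues = hH.eigenvalues :=
    (IsHermitian.eigenvalues_eq_eigenvalues_iff hG hH).2 (charpoly_mul_comm _ _)
  obtain ⟨e, he, htr⟩ := aux_trace T c c' hc hc' hcc'
  have hnn : ∀ x : Fin 3 → ℝ, 0 ≤ T *ᵥ x ⬝ᵥ T *ᵥ x := fun x =>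
    Finset.sum_nonneg fun _ _ => mul_self_nonneg _
  have key : T *ᵥ c ⬝ᵥ T *ᵥ c + T *ᵥ c' ⬝ᵥ T *ᵥ c' ≤ v + vt := by
    have hsum : (T * Tᵀ).trace = ∑ k, hH.eigenvalues k := by
      simpa using hH.trace_eq_sum_eigenvalues
    have hR := fun m h => aux_rayleigh _ hG m h e
    have h3 : e ⬝ᵥ ((Tᵀ * T) *ᵥ e) = T *ᵥ e ⬝ᵥ T *ᵥ e := by
      rw [← mulVec_mulVec, dotProduct_mulVec, ← mulVec_transpose, transpose_transpose]
    rw [heq, h3, he] at hR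
    generalize hH.eigenvalues = d at *
    obtain ⟨k, hki, hkj⟩ : ∃ k, k ≠ i ∧ k ≠ j := by
      clear * -
      revert i j; decide
    have hd : ∑ k, d k = d i + d j + d k := by
      have : (Finset.univ : Finset (Fin 3)) = {i, j, k} := by
        clear * - hij hki hkj
        revert i j k; decide
      rw [this, Finset.sum_insert (by simp [hij, hki.symm]), Finset.sum_insert (by simp [hkj.symm]), Finset.sum_singleton]
      ring
    have hm := htop k hki hkj
    have := hR (d k) (fun l => by
      by_cases h1 : l = i
      · subst h1; rw [← hv]; exact hm.trans (min_le_left _ _)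
      by_cases h2 : l = j
      · subst h2; rw [← hvt]; exact hm.trans (min_le_right _ _)
      have : l = k := by clear * - hij hki hkj h1 h2; omega
      rw [this])
    linarith
  have hA : Real.sqrt (T *ᵥ c ⬝ᵥ T *ᵥ c) * Real.cos θ + Real.sqrt (T *ᵥ c' ⬝ᵥ T *ᵥ c') * Real.sin θ
      ≤ Real.sqrt (v + vt) := by
    apply Real.le_sqrt_of_sq_le
    refine le_trans ?_ key
    have e1 := Real.sq_sqrt (hnn c)
    have e2 := Real.sq_sqrt (hnn c')
    generalize Real.sqrt (T *ᵥ c ⬝ᵥ T *ᵥ c) = p at *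
    generalize Real.sqrt (T *ᵥ c' ⬝ᵥ T *ᵥ c') = q at *
    rw [← e1, ← e2]
    have := Real.sin_sq_add_cos_sq θ
    have h5 : p^2+q^2 = (p^2+q^2) * (Real.sin θ ^ 2 + Real.cos θ ^ 2) := by rw [this, mul_one]
    rw [h5]
    nlinarith [sq_nonneg (p * Real.sin θ - q * Real.cos θ)]
  have hB := aux_cs s (Real.cos θ • c + Real.sin θ • c') gam (by
    simp only [add_dotProduct, dotProduct_add, smul_dotProduct, dotProduct_smul, smul_eq_mul, hc, hc', hcc', dotProduct_comm c' c]
    linarith [Real.sin_sq_add_cos_sq θ])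
  simp only [add_dotProduct, smul_dotProduct, smul_eq_mul] at hB
  have := mul_le_mul_of_nonneg_left hA hlam
  linarith
end

section
/- (Necessity part of Theorem 1.) Let ρ be a density matrix on ℂ² ⊗ ℂ² with correlation matrix T (entries t_ij = Tr[ρ (σ_i ⊗ σ_j)]) and Bob's local Bloch vector s ∈ ℝ³ (components s_i = Tr[ρ (I ⊗ σ_i)]), and let M(ρ) = v + ṽ be the sum of the two largest eigenvalues of T Tᵗ. Then for all unit vectors â, â′, b̂, b̂′ ∈ ℝ³, all λ ≥ 0 and all γ ∈ ℝ, the biased-unsharp CHSH expectation satisfies λ [⟨â, T(b̂ + b̂′)⟩ + ⟨â′, T(b̂ − b̂′)⟩] + 2γ ⟨b̂, s⟩ ≤ 2λ√(M(ρ)) + 2|γ| ‖s‖. In particular, if λ√(M(ρ)) + |γ| ‖s‖ ≤ 1, then the CHSH expression with biased unsharp measurements (sharpness λ, biasedness γ) on Alice's side and projective measurements on Bob's side never exceeds 2. -/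
open Matrix Complex Kronecker
open scoped ComplexOrder

/-- The three Pauli matrices on `ℂ²`. -/
noncomputable def pauli : Fin 3 → Matrix (Fin 2) (Fin 2) ℂ
  | 0 => !![0, 1; 1, 0]
  | 1 => !![0, -Complex.I; Complex.I, 0]
  | 2 => !![1, 0; 0, -1]

lemma aux_cs_s6 {n : ℕ} (x y : Fin n → ℝ) : x ⬝ᵥ y ≤ Real.sqrt (x ⬝ᵥ x) * Real.sqrt (y ⬝ᵥ y) := by
  have := Finset.sum_mul_sq_le_sq_mul_sq Finset.univ x y
  have hx : x ⬝ᵥ x = ∑ i, x i ^ 2 := by simp [dotProduct, pow_two]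
  have hy : y ⬝ᵥ y = ∑ i, y i ^ 2 := by simp [dotProduct, pow_two]
  rw [← Real.sqrt_mul (by rw [hx]; positivity), hx, hy]
  apply Real.le_sqrt_of_sq_le
  exact this

lemma aux_nn (x : Fin 3 → ℝ) : 0 ≤ x ⬝ᵥ x := by
  simp only [dotProduct]
  exact Finset.sum_nonneg fun i _ => mul_self_nonneg _

/-- Bessel for a sub-normalised orthogonal pair. -/
lemma aux_bessel2 (w e f : Fin 3 → ℝ) (he : e ⬝ᵥ e ≤ 1) (hf : f ⬝ᵥ f ≤ 1) (hef : e ⬝ᵥ f = 0) :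
    (w ⬝ᵥ e) ^ 2 + (w ⬝ᵥ f) ^ 2 ≤ w ⬝ᵥ w := by
  have h := aux_nn (w - (w ⬝ᵥ e) • e - (w ⬝ᵥ f) • f)
  simp only [sub_dotProduct, dotProduct_sub, smul_dotProduct, dotProduct_smul, smul_eq_mul,
    hef, dotProduct_comm f e, dotProduct_comm e w, dotProduct_comm f w] at h
  nlinarith [mul_nonneg (sq_nonneg (w ⬝ᵥ e)) (sub_nonneg.2 he),
    mul_nonneg (sq_nonneg (w ⬝ᵥ f)) (sub_nonneg.2 hf)]

lemma aux_bessel3 (w1 w2 w3 e : Fin 3 → ℝ) (m1 m2 m3 : ℝ) (h1 : 0 < m1) (h2 : 0 < m2) (h3 : 0 < m3)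
    (h11 : w1 ⬝ᵥ w1 = m1) (h22 : w2 ⬝ᵥ w2 = m2) (h33 : w3 ⬝ᵥ w3 = m3)
    (h12 : w1 ⬝ᵥ w2 = 0) (h13 : w1 ⬝ᵥ w3 = 0) (h23 : w2 ⬝ᵥ w3 = 0) (he : e ⬝ᵥ e ≤ 1) :
    (w1 ⬝ᵥ e) ^ 2 / m1 + (w2 ⬝ᵥ e) ^ 2 / m2 + (w3 ⬝ᵥ e) ^ 2 / m3 ≤ 1 := by
  have h := aux_nn (e - ((w1 ⬝ᵥ e) / m1) • w1 - ((w2 ⬝ᵥ e) / m2) • w2 - ((w3 ⬝ᵥ e) / m3) • w3)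
  simp only [sub_dotProduct, dotProduct_sub, smul_dotProduct, dotProduct_smul, smul_eq_mul,
    h12, h13, h23, dotProduct_comm w2 w1, dotProduct_comm w3 w1, dotProduct_comm w3 w2, h11, h22, h33,
    dotProduct_comm e w1, dotProduct_comm e w2, dotProduct_comm e w3] at h
  generalize w1 ⬝ᵥ e = x1 at *
  generalize w2 ⬝ᵥ e = x2 at *
  generalize w3 ⬝ᵥ e = x3 at *
  have e1 : x1 / m1 * m1 = x1 := by field_simp
  have e2 : x2 / m2 * m2 = x2 := by field_simp
  have e3 : x3 / m3 * m3 = x3 := by field_simp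
  rw [e1, e2, e3] at h
  have f1 : x1 ^ 2 / m1 = x1 / m1 * x1 := by ring
  have f2 : x2 ^ 2 / m2 = x2 / m2 * x2 := by ring
  have f3 : x3 ^ 2 / m3 = x3 / m3 * x3 := by ring
  rw [f1, f2, f3]
  linarith

lemma aux_kyfan (w1 w2 w3 e f : Fin 3 → ℝ) (m1 m2 m3 : ℝ)
    (h11 : w1 ⬝ᵥ w1 = m1) (h22 : w2 ⬝ᵥ w2 = m2) (h33 : w3 ⬝ᵥ w3 = m3)
    (h12 : w1 ⬝ᵥ w2 = 0) (h13 : w1 ⬝ᵥ w3 = 0) (h23 : w2 ⬝ᵥ w3 = 0)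
    (hm1 : m3 ≤ m1) (hm2 : m3 ≤ m2)
    (he : e ⬝ᵥ e ≤ 1) (hf : f ⬝ᵥ f ≤ 1) (hef : e ⬝ᵥ f = 0) :
    ((w1 ⬝ᵥ e) ^ 2 + (w2 ⬝ᵥ e) ^ 2 + (w3 ⬝ᵥ e) ^ 2) +
    ((w1 ⬝ᵥ f) ^ 2 + (w2 ⬝ᵥ f) ^ 2 + (w3 ⬝ᵥ f) ^ 2) ≤ m1 + m2 := by
  have b1 := aux_bessel2 w1 e f he hf hef
  have b2 := aux_bessel2 w2 e f he hf hef
  have b3 := aux_bessel2 w3 e f he hf hef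
  have n3 : 0 ≤ m3 := h33 ▸ aux_nn w3
  rcases n3.eq_or_lt with h0 | h0
  · linarith
  have p1 : 0 < m1 := by linarith
  have p2 : 0 < m2 := by linarith
  have c1 := aux_bessel3 w1 w2 w3 e m1 m2 m3 p1 p2 h0 h11 h22 h33 h12 h13 h23 he
  have c2 := aux_bessel3 w1 w2 w3 f m1 m2 m3 p1 p2 h0 h11 h22 h33 h12 h13 h23 hf
  rw [h11] at b1
  rw [h22] at b2
  have key : ∀ m x : ℝ, 0 < m → m3 ≤ m → x ≤ m → m3 * (1 - x / m) ≤ m - x := by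
    intro m x hm hmm hx
    have : m - x = m * (1 - x / m) := by field_simp
    rw [this]
    apply mul_le_mul_of_nonneg_right hmm
    rw [sub_nonneg, div_le_one hm]; exact hx
  have k1 := key m1 _ p1 hm1 b1
  have k2 := key m2 _ p2 hm2 b2
  have k3 : m3 * (((w3 ⬝ᵥ e) ^ 2 + (w3 ⬝ᵥ f) ^ 2) / m3) = (w3 ⬝ᵥ e) ^ 2 + (w3 ⬝ᵥ f) ^ 2 := by
    field_simp
  have s : ((w1 ⬝ᵥ e) ^ 2 + (w1 ⬝ᵥ f) ^ 2) / m1 + ((w2 ⬝ᵥ e) ^ 2 + (w2 ⬝ᵥ f) ^ 2) / m2 +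
      ((w3 ⬝ᵥ e) ^ 2 + (w3 ⬝ᵥ f) ^ 2) / m3 ≤ 2 := by
    simp only [add_div]; linarith
  have := mul_le_mul_of_nonneg_left s n3
  linarith

lemma aux_top (T : Matrix (Fin 3) (Fin 3) ℝ) (hH : (T * Tᵀ).IsHermitian)
    (i j : Fin 3) (hij : i ≠ j)
    (htop : ∀ k, k ≠ i → k ≠ j →
      hH.eigenvalues k ≤ hH.eigenvalues i ∧ hH.eigenvalues k ≤ hH.eigenvalues j)
    (e f : Fin 3 → ℝ) (he : e ⬝ᵥ e ≤ 1) (hf : f ⬝ᵥ f ≤ 1) (hef : e ⬝ᵥ f = 0) :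
    (T *ᵥ e) ⬝ᵥ (T *ᵥ e) + (T *ᵥ f) ⬝ᵥ (T *ᵥ f) ≤ hH.eigenvalues i + hH.eigenvalues j := by
  obtain ⟨k, hki, hkj⟩ : ∃ k : Fin 3, k ≠ i ∧ k ≠ j := by
    have h : ∀ i j : Fin 3, ∃ k : Fin 3, k ≠ i ∧ k ≠ j := by decide
    exact h i j
  have huniv : (Finset.univ : Finset (Fin 3)) = {i, j, k} := by
    symm; apply Finset.eq_univ_of_card
    rw [Finset.card_insert_of_notMem, Finset.card_insert_of_notMem] <;> simp [hij, hki.symm, hkj.symm]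
  let U : Fin 3 → Fin 3 → ℝ := fun l => (hH.eigenvectorBasis l).ofLp
  have hU : ∀ l m, U l ⬝ᵥ U m = if l = m then 1 else 0 := by
    intro l m
    have := (orthonormal_iff_ite.1 hH.eigenvectorBasis.orthonormal) m l
    rw [EuclideanSpace.inner_eq_star_dotProduct] at this
    simpa [U, eq_comm] using this
  have hA : ∀ l, (T * Tᵀ) *ᵥ U l = hH.eigenvalues l • U l := fun l => hH.mulVec_eigenvectorBasis l
  have hP : ∀ x : Fin 3 → ℝ, x ⬝ᵥ x = ∑ l, (U l ⬝ᵥ x) ^ 2 := by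
    intro x
    have := hH.eigenvectorBasis.sum_sq_norm_inner_right (WithLp.toLp 2 x)
    simp only [EuclideanSpace.inner_eq_star_dotProduct, EuclideanSpace.norm_sq_eq] at this
    simp only [Real.norm_eq_abs, sq_abs] at this
    simp only [dotProduct_comm (U _) x]
    rw [show x ⬝ᵥ x = ∑ i, x i ^ 2 by simp [dotProduct, pow_two]]
    simpa [U] using this.symm
  have hW : ∀ l x, U l ⬝ᵥ (T *ᵥ x) = (Tᵀ *ᵥ U l) ⬝ᵥ x := by
    intro l x
    rw [dotProduct_mulVec, mulVec_transpose]
  have hWW : ∀ l m, (Tᵀ *ᵥ U l) ⬝ᵥ (Tᵀ *ᵥ U m) = if l = m then hH.eigenvalues m else 0 := by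
    intro l m
    rw [← hW, mulVec_mulVec, hA, dotProduct_smul, hU]
    simp
  have S : ∀ g : Fin 3 → ℝ, ∑ l, g l = g i + g j + g k := by
    intro g
    rw [huniv, Finset.sum_insert, Finset.sum_insert, Finset.sum_singleton, add_assoc] <;>
      simp [hij, hki.symm, hkj.symm]
  rw [hP (T *ᵥ e), hP (T *ᵥ f)]
  simp only [hW, S]
  refine aux_kyfan _ _ _ e f _ _ (hH.eigenvalues k) ?_ ?_ ?_ ?_ ?_ ?_ (htop k hki hkj).1
    (htop k hki hkj).2 he hf hef <;> rw [hWW] <;> simp [hij, hki.symm, hkj.symm]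

lemma aux_unit (c : Fin 3 → ℝ) : ∃ e : Fin 3 → ℝ, e ⬝ᵥ e ≤ 1 ∧ c = Real.sqrt (c ⬝ᵥ c) • e ∧
    e = (Real.sqrt (c ⬝ᵥ c))⁻¹ • c := by
  refine ⟨(Real.sqrt (c ⬝ᵥ c))⁻¹ • c, ?_, ?_, rfl⟩
  · simp only [smul_dotProduct, dotProduct_smul, smul_eq_mul]
    rw [← mul_assoc, ← mul_inv, Real.mul_self_sqrt (aux_nn c)]
    exact inv_mul_le_one
  · by_cases h : c ⬝ᵥ c = 0
    · rw [dotProduct_self_eq_zero.1 h]; simp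
    · rw [smul_smul, mul_inv_cancel₀, one_smul]
      rw [Real.sqrt_ne_zero (aux_nn c)]; exact h

theorem chsh_necessity
    (ρ : Matrix (Fin 2 × Fin 2) (Fin 2 × Fin 2) ℂ)
    (hρ : ρ.PosSemidef) (hρtr : ρ.trace = 1)
    (T : Matrix (Fin 3) (Fin 3) ℝ) (s : Fin 3 → ℝ)
    (hT : ∀ i j, (T i j : ℂ) = (ρ * (pauli i ⊗ₖ pauli j)).trace)
    (hs : ∀ i, (s i : ℂ) = (ρ * ((1 : Matrix (Fin 2) (Fin 2) ℂ) ⊗ₖ pauli i)).trace)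
    (hH : (T * Tᵀ).IsHermitian)
    (v vt M : ℝ) (i j : Fin 3) (hij : i ≠ j)
    (hv : v = hH.eigenvalues i) (hvt : vt = hH.eigenvalues j)
    (htop : ∀ k, k ≠ i → k ≠ j → hH.eigenvalues k ≤ min v vt)
    (hM : M = v + vt)
    (a a' b b' : Fin 3 → ℝ)
    (ha : a ⬝ᵥ a = 1) (ha' : a' ⬝ᵥ a' = 1) (hb : b ⬝ᵥ b = 1) (hb' : b' ⬝ᵥ b' = 1)
    (lam gam : ℝ) (hlam : 0 ≤ lam) :
    lam * ((a ⬝ᵥ T.mulVec (b + b')) + (a' ⬝ᵥ T.mulVec (b - b'))) + 2 * gam * (b ⬝ᵥ s)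
      ≤ 2 * lam * Real.sqrt M + 2 * |gam| * Real.sqrt (s ⬝ᵥ s) ∧
    (lam * Real.sqrt M + |gam| * Real.sqrt (s ⬝ᵥ s) ≤ 1 →
      lam * ((a ⬝ᵥ T.mulVec (b + b')) + (a' ⬝ᵥ T.mulVec (b - b'))) + 2 * gam * (b ⬝ᵥ s)
        ≤ 2) := by
  have hmin := fun k h1 h2 => le_min_iff.1 (htop k h1 h2)
  subst hv hvt hM
  have hmain : (a ⬝ᵥ T.mulVec (b + b')) + (a' ⬝ᵥ T.mulVec (b - b')) ≤
      2 * Real.sqrt (hH.eigenvalues i + hH.eigenvalues j) := by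
    obtain ⟨e, he, hce, he'⟩ := aux_unit (b + b')
    obtain ⟨f, hf, hdf, hf'⟩ := aux_unit (b - b')
    have hef : e ⬝ᵥ f = 0 := by
      rw [he', hf']
      simp only [smul_dotProduct, dotProduct_smul, add_dotProduct, dotProduct_sub, smul_eq_mul,
        hb, hb', dotProduct_comm b' b]
      ring
    have hK := aux_top T hH i j hij hmin e f he hf hef
    have hp := Real.sq_sqrt (aux_nn (b + b'))
    have hq := Real.sq_sqrt (aux_nn (b - b'))
    have hp0 := Real.sqrt_nonneg ((b + b') ⬝ᵥ (b + b'))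
    have hq0 := Real.sqrt_nonneg ((b - b') ⬝ᵥ (b - b'))
    have hpq : Real.sqrt ((b + b') ⬝ᵥ (b + b')) ^ 2 + Real.sqrt ((b - b') ⬝ᵥ (b - b')) ^ 2 = 4 := by
      rw [hp, hq]
      simp only [add_dotProduct, dotProduct_add, sub_dotProduct, dotProduct_sub, hb, hb',
        dotProduct_comm b' b]
      ring
    generalize Real.sqrt ((b + b') ⬝ᵥ (b + b')) = p at *
    generalize Real.sqrt ((b - b') ⬝ᵥ (b - b')) = q at *
    rw [hce, hdf, mulVec_smul, mulVec_smul, dotProduct_smul, dotProduct_smul, smul_eq_mul,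
      smul_eq_mul]
    have h1 := aux_cs_s6 a (T *ᵥ e)
    have h2 := aux_cs_s6 a' (T *ᵥ f)
    rw [ha, Real.sqrt_one, one_mul] at h1
    rw [ha', Real.sqrt_one, one_mul] at h2
    have hx := Real.sq_sqrt (aux_nn (T *ᵥ e))
    have hy := Real.sq_sqrt (aux_nn (T *ᵥ f))
    have hz := Real.sq_sqrt (le_trans (add_nonneg (aux_nn (T *ᵥ e)) (aux_nn (T *ᵥ f))) hK)
    have hz0 := Real.sqrt_nonneg (hH.eigenvalues i + hH.eigenvalues j)
    generalize Real.sqrt (hH.eigenvalues i + hH.eigenvalues j) = z at *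
    generalize Real.sqrt ((T *ᵥ e) ⬝ᵥ (T *ᵥ e)) = x at *
    generalize Real.sqrt ((T *ᵥ f) ⬝ᵥ (T *ᵥ f)) = y at *
    have h3 : p * x + q * y ≤ 2 * z := by
      apply le_of_sq_le_sq _ (by positivity)
      have hxy : x ^ 2 + y ^ 2 ≤ z ^ 2 := by rw [hx, hy, hz]; exact hK
      have : (p * x + q * y) ^ 2 + (p * y - q * x) ^ 2 = (p ^ 2 + q ^ 2) * (x ^ 2 + y ^ 2) := by ring
      rw [hpq] at this
      nlinarith [sq_nonneg (p * y - q * x)]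
    have := mul_le_mul_of_nonneg_left h1 hp0
    have := mul_le_mul_of_nonneg_left h2 hq0
    linarith
  have hg : gam * (b ⬝ᵥ s) ≤ |gam| * Real.sqrt (s ⬝ᵥ s) := by
    have h1 := aux_cs_s6 b s
    have h2 := aux_cs_s6 (-b) s
    rw [neg_dotProduct_neg] at h2
    rw [neg_dotProduct] at h2
    rw [hb, Real.sqrt_one, one_mul] at h1 h2
    calc gam * (b ⬝ᵥ s) ≤ |gam * (b ⬝ᵥ s)| := le_abs_self _
      _ = |gam| * |b ⬝ᵥ s| := abs_mul _ _
      _ ≤ _ := mul_le_mul_of_nonneg_left (abs_le.2 ⟨by linarith, h1⟩) (abs_nonneg _)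
  have hl := mul_le_mul_of_nonneg_left hmain hlam
  constructor
  · linarith
  · intro h
    linarith
end

section
/- (Corollary 1.) Let ρ be a density matrix on ℂ² ⊗ ℂ² with correlation matrix T (t_ij = Tr[ρ (σ_i ⊗ σ_j)]) and Bob's Bloch vector s (s_i = Tr[ρ (I ⊗ σ_i)]), and suppose M(ρ) ≤ 1, where M(ρ) is the sum of the two largest eigenvalues of T Tᵗ, and ‖s‖ ≤ 1. Then for all λ ≥ 0 and γ ∈ ℝ with |λ| + |γ| ≤ 1 and all unit vectors â, â′, b̂, b̂′ ∈ ℝ³, the biased-unsharp CHSH expectation satisfies λ [⟨â, T(b̂ + b̂′)⟩ + ⟨â′, T(b̂ − b̂′)⟩] + 2γ ⟨b̂, s⟩ ≤ 2. That is, if a two-qubit state does not violate the CHSH inequality with projective measurements on both sides, it does not violate it with any dichotomic POVM on one side. -/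
open Matrix Complex Kronecker
open scoped ComplexOrder

theorem aux_cs_s8 (a x : Fin 3 → ℝ) (ha : a ⬝ᵥ a = 1) : (a ⬝ᵥ x) ^ 2 ≤ x ⬝ᵥ x := by
  simp only [dotProduct, Fin.sum_univ_three] at *
  nlinarith [sq_nonneg (a 0 * x 1 - a 1 * x 0), sq_nonneg (a 0 * x 2 - a 2 * x 0),
    sq_nonneg (a 1 * x 2 - a 2 * x 1), congrArg (fun t => t * (x 0 * x 0 + x 1 * x 1 + x 2 * x 2)) ha]

theorem aux_spec (T : Matrix (Fin 3) (Fin 3) ℝ) (hH : (T * Tᵀ).IsHermitian) (μ : ℝ)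
    (h : μ ∈ spectrum ℝ (Tᵀ * T)) : ∃ k, hH.eigenvalues k = μ := by
  rw [Matrix.mem_spectrum_iff_isRoot_charpoly, Matrix.charpoly_mul_comm,
    ← Matrix.mem_spectrum_iff_isRoot_charpoly, hH.spectrum_real_eq_range_eigenvalues] at h
  exact h

theorem aux_quad (T : Matrix (Fin 3) (Fin 3) ℝ) (x : Fin 3 → ℝ) :
    x ⬝ᵥ (Tᵀ * T).mulVec x = T.mulVec x ⬝ᵥ T.mulVec x := by
  rw [← Matrix.mulVec_mulVec, Matrix.dotProduct_mulVec, Matrix.vecMul_transpose]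

theorem aux_lo (T : Matrix (Fin 3) (Fin 3) ℝ) (hH : (T * Tᵀ).IsHermitian) (c : ℝ)
    (h : ∀ k, c ≤ hH.eigenvalues k) (x : Fin 3 → ℝ) :
    c * (x ⬝ᵥ x) ≤ T.mulVec x ⬝ᵥ T.mulVec x := by
  have hA : (Tᵀ * T).IsHermitian := by
    simpa using Matrix.isHermitian_conjTranspose_mul_self T
  have hps : (Tᵀ * T - algebraMap ℝ _ c).PosSemidef := by
    rw [Matrix.posSemidef_iff_isHermitian_and_spectrum_nonneg]
    refine ⟨hA.sub (by rw [Matrix.IsHermitian, Matrix.algebraMap_eq_diagonal]; simp), ?_⟩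
    intro μ hμ
    rw [← spectrum.sub_singleton_eq] at hμ
    obtain ⟨y, hy, z, rfl, rfl⟩ := hμ
    obtain ⟨k, hk⟩ := aux_spec T hH y hy
    have := h k
    simp only [Set.mem_ofPred_eq]
    linarith
  have := hps.dotProduct_mulVec_nonneg x
  rw [Matrix.sub_mulVec, Algebra.algebraMap_eq_smul_one, Matrix.smul_mulVec, Matrix.one_mulVec,
    dotProduct_sub, dotProduct_smul, star_trivial, aux_quad, smul_eq_mul] at this
  linarith

theorem aux_hi (T : Matrix (Fin 3) (Fin 3) ℝ) (hH : (T * Tᵀ).IsHermitian) (c : ℝ)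
    (h : ∀ k, hH.eigenvalues k ≤ c) (x : Fin 3 → ℝ) :
    T.mulVec x ⬝ᵥ T.mulVec x ≤ c * (x ⬝ᵥ x) := by
  have hA : (Tᵀ * T).IsHermitian := by
    simpa using Matrix.isHermitian_conjTranspose_mul_self T
  have hps : (algebraMap ℝ _ c - Tᵀ * T).PosSemidef := by
    rw [Matrix.posSemidef_iff_isHermitian_and_spectrum_nonneg]
    refine ⟨Matrix.IsHermitian.sub
      (by rw [Matrix.IsHermitian, Matrix.algebraMap_eq_diagonal]; simp) hA, ?_⟩
    intro μ hμ
    rw [← spectrum.singleton_sub_eq] at hμ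
    obtain ⟨z, rfl, y, hy, rfl⟩ := hμ
    obtain ⟨k, hk⟩ := aux_spec T hH y hy
    have := h k
    simp only [Set.mem_ofPred_eq]
    linarith
  have := hps.dotProduct_mulVec_nonneg x
  rw [Matrix.sub_mulVec, Algebra.algebraMap_eq_smul_one, Matrix.smul_mulVec, Matrix.one_mulVec,
    dotProduct_sub, dotProduct_smul, star_trivial, aux_quad, smul_eq_mul] at this
  linarith

theorem aux_row (r p q : Fin 3 → ℝ) (h : p ⬝ᵥ q = 0) :
    (r ⬝ᵥ p) ^ 2 * (q ⬝ᵥ q) + (r ⬝ᵥ q) ^ 2 * (p ⬝ᵥ p) + (r ⬝ᵥ (crossProduct p q)) ^ 2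
      = (p ⬝ᵥ p) * (q ⬝ᵥ q) * (r ⬝ᵥ r) := by
  have e : (r ⬝ᵥ p) ^ 2 * (q ⬝ᵥ q) + (r ⬝ᵥ q) ^ 2 * (p ⬝ᵥ p) + (r ⬝ᵥ (crossProduct p q)) ^ 2
      = (p ⬝ᵥ p) * (q ⬝ᵥ q) * (r ⬝ᵥ r)
        + (p ⬝ᵥ q) * (2 * (r ⬝ᵥ p) * (r ⬝ᵥ q) - (r ⬝ᵥ r) * (p ⬝ᵥ q)) := by
    simp [cross_apply, dotProduct, Fin.sum_univ_three]
    ring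
  rw [e, h]; ring

theorem aux_mat (T : Matrix (Fin 3) (Fin 3) ℝ) (p q : Fin 3 → ℝ) (h : p ⬝ᵥ q = 0) :
    (T.mulVec p ⬝ᵥ T.mulVec p) * (q ⬝ᵥ q) + (T.mulVec q ⬝ᵥ T.mulVec q) * (p ⬝ᵥ p)
      + T.mulVec (crossProduct p q) ⬝ᵥ T.mulVec (crossProduct p q)
      = (p ⬝ᵥ p) * (q ⬝ᵥ q) * (T * Tᵀ).trace := by
  have e : ∀ x, T.mulVec x ⬝ᵥ T.mulVec x = (T 0 ⬝ᵥ x) ^ 2 + (T 1 ⬝ᵥ x) ^ 2 + (T 2 ⬝ᵥ x) ^ 2 := by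
    intro x
    rw [dotProduct, Fin.sum_univ_three]
    simp only [Matrix.mulVec]
    ring
  have t : (T * Tᵀ).trace = T 0 ⬝ᵥ T 0 + T 1 ⬝ᵥ T 1 + T 2 ⬝ᵥ T 2 := by
    simp [Matrix.trace, Fin.sum_univ_three, Matrix.mul_apply, dotProduct]
  rw [e, e, e, t]
  linear_combination aux_row (T 0) p q h + aux_row (T 1) p q h + aux_row (T 2) p q h

theorem aux_chsh (T : Matrix (Fin 3) (Fin 3) ℝ) (hH : (T * Tᵀ).IsHermitian)
    (i j : Fin 3) (hij : i ≠ j)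
    (htop : ∀ k, k ≠ i → k ≠ j →
      hH.eigenvalues k ≤ min (hH.eigenvalues i) (hH.eigenvalues j))
    (hM : hH.eigenvalues i + hH.eigenvalues j ≤ 1)
    (a a' p q : Fin 3 → ℝ) (ha : a ⬝ᵥ a = 1) (ha' : a' ⬝ᵥ a' = 1)
    (hpq : p ⬝ᵥ q = 0) (h4 : p ⬝ᵥ p + q ⬝ᵥ q = 4) :
    a ⬝ᵥ T.mulVec p + a' ⬝ᵥ T.mulVec q ≤ 2 := by
  have hpos : ∀ k, 0 ≤ hH.eigenvalues k := by
    have : (T * Tᵀ).PosSemidef := by simpa using Matrix.posSemidef_self_mul_conjTranspose T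
    exact this.eigenvalues_nonneg
  obtain ⟨k, hki, hkj⟩ : ∃ k : Fin 3, k ≠ i ∧ k ≠ j := by
    clear * -
    revert i j; decide
  have hall : ∀ l : Fin 3, l = i ∨ l = j ∨ l = k := by
    clear * - hij hki hkj
    revert i j k; decide
  have hk := htop k hki hkj
  rw [le_min_iff] at hk
  have hi0 := hpos i
  have hj0 := hpos j
  have htr : (T * Tᵀ).trace = hH.eigenvalues i + hH.eigenvalues j + hH.eigenvalues k := by
    rw [hH.trace_eq_sum_eigenvalues]
    have : (Finset.univ : Finset (Fin 3)) = {i, j, k} := by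
      ext l; simpa using hall l
    rw [this, Finset.sum_insert (by simp [hij, hki.symm]), Finset.sum_insert (by simp [hkj.symm]),
      Finset.sum_singleton]
    simp; ring
  have h1 : ∀ l, hH.eigenvalues l ≤ 1 := by
    intro l; rcases hall l with rfl | rfl | rfl <;> linarith
  have h2 : ∀ l, hH.eigenvalues k ≤ hH.eigenvalues l := by
    intro l; rcases hall l with rfl | rfl | rfl <;> linarith
  have hlo := aux_lo T hH _ h2 (crossProduct p q)
  have hcr : crossProduct p q ⬝ᵥ crossProduct p q = (p ⬝ᵥ p) * (q ⬝ᵥ q) := by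
    rw [cross_dot_cross, dotProduct_comm q p, hpq]; ring
  have hm := aux_mat T p q hpq
  rw [hcr] at hlo
  have hp1 := aux_hi T hH 1 h1 p
  have hq1 := aux_hi T hH 1 h1 q
  have hx := aux_cs_s8 a (T.mulVec p) ha
  have hy := aux_cs_s8 a' (T.mulVec q) ha'
  have hP : 0 ≤ p ⬝ᵥ p := by simpa using dotProduct_star_self_nonneg p
  have hQ : 0 ≤ q ⬝ᵥ q := by simpa using dotProduct_star_self_nonneg q
  rw [htr] at hm
  generalize a ⬝ᵥ T.mulVec p = x at *
  generalize a' ⬝ᵥ T.mulVec q = y at *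
  generalize T.mulVec p ⬝ᵥ T.mulVec p = A at *
  generalize T.mulVec q ⬝ᵥ T.mulVec q = B at *
  generalize p ⬝ᵥ p = P at *
  generalize q ⬝ᵥ q = Q at *
  have hPQ : 0 ≤ P * Q := mul_nonneg hP hQ
  have key : A * Q + B * P ≤ P * Q := by nlinarith [mul_le_mul_of_nonneg_left hM hPQ]
  have key2 : x ^ 2 * Q + y ^ 2 * P ≤ P * Q := by
    nlinarith [mul_le_mul_of_nonneg_right hx hQ, mul_le_mul_of_nonneg_right hy hP]
  rcases hP.eq_or_lt with h0 | hP'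
  · have : x = 0 := by nlinarith
    nlinarith
  rcases hQ.eq_or_lt with h0 | hQ'
  · have : y = 0 := by nlinarith
    nlinarith
  have hfin : (x + y) ^ 2 * (P * Q) ≤ 4 * (P * Q) := by
    have e : (x + y) ^ 2 * (P * Q) + (x * Q - y * P) ^ 2 = (x ^ 2 * Q + y ^ 2 * P) * (P + Q) := by
      ring
    rw [h4] at e
    nlinarith [sq_nonneg (x * Q - y * P)]
  have := le_of_mul_le_mul_right hfin (mul_pos hP' hQ')
  nlinarith

theorem no_chsh_violation_with_one_sided_povm
    (ρ : Matrix (Fin 2 × Fin 2) (Fin 2 × Fin 2) ℂ)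
    (hρ : ρ.PosSemidef) (hρtr : ρ.trace = 1)
    (T : Matrix (Fin 3) (Fin 3) ℝ) (s : Fin 3 → ℝ)
    (hT : ∀ i j, (T i j : ℂ) = (ρ * (pauli i ⊗ₖ pauli j)).trace)
    (hs : ∀ i, (s i : ℂ) = (ρ * ((1 : Matrix (Fin 2) (Fin 2) ℂ) ⊗ₖ pauli i)).trace)
    (hH : (T * Tᵀ).IsHermitian)
    (v vt : ℝ) (i j : Fin 3) (hij : i ≠ j)
    (hv : v = hH.eigenvalues i) (hvt : vt = hH.eigenvalues j)
    (htop : ∀ k, k ≠ i → k ≠ j → hH.eigenvalues k ≤ min v vt)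
    (hM : v + vt ≤ 1)
    (hsnorm : Real.sqrt (s ⬝ᵥ s) ≤ 1) :
    ∀ (lam gam : ℝ), 0 ≤ lam → |lam| + |gam| ≤ 1 →
    ∀ (a a' b b' : Fin 3 → ℝ),
      a ⬝ᵥ a = 1 → a' ⬝ᵥ a' = 1 → b ⬝ᵥ b = 1 → b' ⬝ᵥ b' = 1 →
      lam * ((a ⬝ᵥ T.mulVec (b + b')) + (a' ⬝ᵥ T.mulVec (b - b'))) + 2 * gam * (b ⬝ᵥ s)
        ≤ 2 := by
  intro lam gam hl hlg a a' b b' ha ha' hb hb'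
  subst hv hvt
  have hc := aux_chsh T hH i j hij htop hM a a' (b + b') (b - b') ha ha'
    (by rw [add_dotProduct, dotProduct_sub, dotProduct_sub, dotProduct_comm b' b, hb, hb']; ring)
    (by
      rw [add_dotProduct, sub_dotProduct, dotProduct_sub, dotProduct_sub, dotProduct_add,
        dotProduct_add, dotProduct_comm b' b, hb, hb']; ring)
  have hbs := aux_cs_s8 b s hb
  have hss : s ⬝ᵥ s ≤ 1 := by
    rw [Real.sqrt_le_one] at hsnorm
    exact hsnorm
  have hb1 : |b ⬝ᵥ s| ≤ 1 := by
    rw [← sq_le_one_iff_abs_le_one]; linarith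
  have hg : gam * (b ⬝ᵥ s) ≤ |gam| := by
    calc gam * (b ⬝ᵥ s) ≤ |gam * (b ⬝ᵥ s)| := le_abs_self _
      _ = |gam| * |b ⬝ᵥ s| := abs_mul _ _
      _ ≤ |gam| * 1 := mul_le_mul_of_nonneg_left hb1 (abs_nonneg _)
      _ = |gam| := mul_one _
  have := mul_le_mul_of_nonneg_left hc hl
  rw [abs_of_nonneg hl] at hlg
  linarith
end

section
/- Let λ, γ ∈ ℝ with 0 < λ and |λ| + |γ| ≤ 1. Then √((1−γ)² − λ²) + √((1+γ)² − λ²) < 2. Consequently the quantity K_NSIT = (λ/4)·(2 − √((1−γ)² − λ²) − √((1+γ)² − λ²)) is strictly positive for every sharpness λ > 0 and every admissible biasedness γ; in particular the NSIT condition K_NSIT = 0 is violated for any nonzero sharpness, with or without biasedness. -/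
theorem nsit_violated_for_any_nonzero_sharpness
    (lam gam : ℝ) (hlam : 0 < lam) (hval : |lam| + |gam| ≤ 1) :
    Real.sqrt ((1 - gam) ^ 2 - lam ^ 2) + Real.sqrt ((1 + gam) ^ 2 - lam ^ 2) < 2 ∧
    0 < lam / 4 * (2 - Real.sqrt ((1 - gam) ^ 2 - lam ^ 2)
        - Real.sqrt ((1 + gam) ^ 2 - lam ^ 2)) := by
  rw [abs_of_pos hlam] at hval
  have h1 := le_abs_self gam
  have h2 := neg_abs_le gam
  have hl : 0 < lam ^ 2 := by positivity
  have ha : Real.sqrt ((1 - gam) ^ 2 - lam ^ 2) < 1 - gam :=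
    (Real.sqrt_lt' (by linarith)).2 (by linarith)
  have hb : Real.sqrt ((1 + gam) ^ 2 - lam ^ 2) < 1 + gam :=
    (Real.sqrt_lt' (by linarith)).2 (by linarith)
  exact ⟨by linarith, mul_pos (by linarith) (by linarith)⟩
end

section
/- Fix λ ∈ (0, 1). The function g(γ) = √((1−γ)² − λ²) + √((1+γ)² − λ²) is strictly decreasing in γ on the interval [0, 1−λ]. Consequently, for fixed sharpness λ ∈ (0,1), the quantity K_NSIT = (λ/4)·(2 − g(γ)) is strictly increasing in the biasedness |γ| on [0, 1−λ]: introducing nonzero biasedness increases the quantum violation of the NSIT condition. -/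
theorem nsit_aux (lam : ℝ) (hlam : lam ∈ Set.Ioo (0 : ℝ) 1) :
    StrictAntiOn (fun gam : ℝ =>
        Real.sqrt ((1 - gam) ^ 2 - lam ^ 2) + Real.sqrt ((1 + gam) ^ 2 - lam ^ 2))
      (Set.Icc 0 (1 - lam)) := by
  obtain ⟨l0, l1⟩ := hlam
  rintro x ⟨x0, x1⟩ y ⟨y0, y1⟩ hxy
  simp only
  have hy : 0 < y := by linarith
  have hl2 : 0 < lam ^ 2 := by positivity
  have hk0 : 0 < 1 - lam ^ 2 := by nlinarith
  obtain ⟨k, hk⟩ : ∃ k, k = Real.sqrt (1 - lam ^ 2) := ⟨_, rfl⟩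
  have kpos : 0 < k := hk ▸ Real.sqrt_pos.2 hk0
  have k2 : k ^ 2 = 1 - lam ^ 2 := hk ▸ Real.sq_sqrt hk0.le
  have a2 := Real.sq_sqrt (show 0 ≤ (1 - x) ^ 2 - lam ^ 2 by nlinarith)
  have c2 := Real.sq_sqrt (show 0 ≤ (1 - y) ^ 2 - lam ^ 2 by nlinarith)
  have b2 := Real.sq_sqrt (show 0 ≤ (1 + x) ^ 2 - lam ^ 2 by nlinarith)
  have d2 := Real.sq_sqrt (show 0 ≤ (1 + y) ^ 2 - lam ^ 2 by nlinarith)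
  have a0 := Real.sqrt_nonneg ((1 - x) ^ 2 - lam ^ 2)
  have c0 := Real.sqrt_nonneg ((1 - y) ^ 2 - lam ^ 2)
  have b0 := Real.sqrt_nonneg ((1 + x) ^ 2 - lam ^ 2)
  have d0 := Real.sqrt_nonneg ((1 + y) ^ 2 - lam ^ 2)
  generalize Real.sqrt ((1 - x) ^ 2 - lam ^ 2) = a at *
  generalize Real.sqrt ((1 - y) ^ 2 - lam ^ 2) = c at *
  generalize Real.sqrt ((1 + x) ^ 2 - lam ^ 2) = b at *
  generalize Real.sqrt ((1 + y) ^ 2 - lam ^ 2) = d at *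
  have ha : a ≤ k * (1 - x) := by
    apply le_of_pow_le_pow_left₀ two_ne_zero (mul_nonneg kpos.le (by linarith))
    rw [mul_pow, k2, a2]
    nlinarith [mul_nonneg hl2.le (mul_nonneg x0 (show 0 ≤ 2 - x by linarith))]
  have hc : c < k * (1 - y) := by
    apply lt_of_pow_lt_pow_left₀ 2 (mul_nonneg kpos.le (by linarith))
    rw [mul_pow, k2, c2]
    nlinarith [mul_pos hl2 (mul_pos hy (show 0 < 2 - y by linarith))]
  have hb : k * (1 + x) ≤ b := by
    apply le_of_pow_le_pow_left₀ two_ne_zero b0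
    rw [mul_pow, k2, b2]
    nlinarith [mul_nonneg hl2.le (mul_nonneg x0 (show 0 ≤ 2 + x by linarith))]
  have hd : k * (1 + y) < d := by
    apply lt_of_pow_lt_pow_left₀ 2 d0
    rw [mul_pow, k2, d2]
    nlinarith [mul_pos hl2 (mul_pos hy (show 0 < 2 + y by linarith))]
  have e1 : (d - b) * (d + b) = (y - x) * (2 + x + y) := by linear_combination d2 - b2
  have e2 : (a - c) * (a + c) = (y - x) * (2 - x - y) := by linear_combination a2 - c2
  have p1 : 0 < (y - x) * (2 + x + y) := mul_pos (by linarith) (by linarith)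
  have p2 : 0 < (y - x) * (2 - x - y) := mul_pos (by linarith) (by linarith)
  have q1 : 0 < d - b := by
    by_contra h
    have := mul_nonpos_of_nonpos_of_nonneg (not_lt.1 h) (add_nonneg d0 b0)
    linarith
  have q2 : 0 < a - c := by
    by_contra h
    have := mul_nonpos_of_nonpos_of_nonneg (not_lt.1 h) (add_nonneg a0 c0)
    linarith
  have r1 : k * (d - b) < y - x := by
    have : (d - b) * (k * (2 + x + y)) < (d - b) * (d + b) :=
      mul_lt_mul_of_pos_left (by linarith) q1
    rw [e1] at this
    exact lt_of_mul_lt_mul_right (by linarith : k * (d - b) * (2 + x + y) < _) (by linarith)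
  have r2 : y - x < k * (a - c) := by
    have : (a - c) * (a + c) < (a - c) * (k * (2 - x - y)) :=
      mul_lt_mul_of_pos_left (by linarith) q2
    rw [e2] at this
    exact lt_of_mul_lt_mul_right (by linarith : _ < k * (a - c) * (2 - x - y)) (by linarith)
  have := lt_of_mul_lt_mul_left (r1.trans r2) kpos.le
  linarith



theorem nsit_increasing_in_biasedness
    (lam : ℝ) (hlam : lam ∈ Set.Ioo (0 : ℝ) 1) :
    StrictAntiOn (fun gam : ℝ =>
        Real.sqrt ((1 - gam) ^ 2 - lam ^ 2) + Real.sqrt ((1 + gam) ^ 2 - lam ^ 2))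
      (Set.Icc 0 (1 - lam)) ∧
    StrictMonoOn (fun gam : ℝ =>
        lam / 4 * (2 - (Real.sqrt ((1 - gam) ^ 2 - lam ^ 2)
          + Real.sqrt ((1 + gam) ^ 2 - lam ^ 2))))
      (Set.Icc 0 (1 - lam)) := by

  refine ⟨nsit_aux lam hlam, ?_⟩
  intro x hx y hy hxy
  have h := nsit_aux lam hlam hx hy hxy
  simp only at h ⊢
  have := hlam.1
  exact mul_lt_mul_of_pos_left (by linarith) (by linarith)
end
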